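/- Let S = ℚ[x, y, z] and let M ⊆ S^6 be the submodule of tuples (g_1, g_2, g_3, g_4, g_5, g_6) satisfying: (x + 3y − 3z) divides g_1 − g_2, x divides g_1 − g_4, (4x − y + 3z) divides g_3 − g_4, (x − y) divides g_3 − g_6, y divides g_2 − g_5, and (3x − 4y − 3z) divides g_5 − g_6. Then M is not a free S-module; equivalently, Ext^1_S(M, S) ≠ 0, and the associated coherent sheaf on ℙ² is a rank-6 vector bundle that does not split as a direct sum of line bundles. -/

import Mathlib

open CategoryTheory CategoryTheory.Limits MvPolynomial

/-- The ring `S = ℚ[x, y, z]`. -/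
abbrev S : Type := MvPolynomial (Fin 3) ℚ

/-- The Billera–Rose submodule of `S^N` cut out by a list of conditions
`(ℓ, a, b)`, each requiring `ℓ ∣ g_a - g_b`. -/
noncomputable def splineBR {N : ℕ} (conds : List (S × Fin N × Fin N)) :
    Submodule S (Fin N → S) where
  carrier := {g | ∀ c ∈ conds, c.1 ∣ g c.2.1 - g c.2.2}
  add_mem' := by
    intro a b ha hb c hc
    simpa [sub_add_sub_comm] using dvd_add (ha c hc) (hb c hc)
  zero_mem' := by
    intro c hc
    simp
  smul_mem' := by
    intro r g hg c hc
    simpa [smul_eq_mul, mul_sub] using (hg c hc).mul_left r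

/-- The spline module `M = C^0(Σ) ⊆ S^6` of the cone over the triangulated annulus
(central triangle removed): tuples `(g_1, …, g_6)` with `x+3y-3z ∣ g_1-g_2`,
`x ∣ g_1-g_4`, `4x-y+3z ∣ g_3-g_4`, `x-y ∣ g_3-g_6`, `y ∣ g_2-g_5`,
`3x-4y-3z ∣ g_5-g_6`. -/
noncomputable def M : Submodule S (Fin 6 → S) :=
  splineBR [(X 0 + 3 * X 1 - 3 * X 2, 0, 1), (X 0, 0, 3),
    (4 * X 0 - X 1 + 3 * X 2, 2, 3), (X 0 - X 1, 2, 5), (X 1, 1, 4),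
    (3 * X 0 - 4 * X 1 - 3 * X 2, 4, 5)]

/-- `Ext^j_S(N, S)`, as a module in `ModuleCat S`. -/
noncomputable def extAgainstRing (j : ℕ) (N : ModuleCat S) : ModuleCat S :=
  ((Ext S (ModuleCat S) j).obj (Opposite.op N)).obj (ModuleCat.of S S)

/-- Vanishing of `Ext^1` makes every short exact sequence split. -/
lemma exists_retraction_of_isZero_ext (T : ShortComplex (ModuleCat.{0} S)) (hT : T.ShortExact)
    (h : IsZero (((Ext S (ModuleCat.{0} S) 1).obj (Opposite.op T.X₃)).obj T.X₁)) :
    ∃ r : T.X₂ ⟶ T.X₁, T.f ≫ r = 𝟙 _ := by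
  have := hT.mono_f
  have := hT.epi_g
  let P := projectiveResolution T.X₃
  have h1 : IsZero ((P.complex.linearYonedaObj S T.X₁).homology 1) :=
    IsZero.of_iso h (P.isoExt 1 T.X₁).symm
  rw [← HomologicalComplex.exactAt_iff_isZero_homology,
    HomologicalComplex.exactAt_iff' _ 0 1 2 (by simp) (by simp),
    ShortComplex.moduleCat_exact_iff] at h1
  have key : ∀ φ : P.complex.X 1 ⟶ T.X₁, P.complex.d 2 1 ≫ φ = 0 →
      ∃ ψ : P.complex.X 0 ⟶ T.X₁, P.complex.d 1 0 ≫ ψ = φ := fun φ hφ => h1 φ hφ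
  let p : P.complex.X 0 ⟶ T.X₃ := P.π.f 0
  have hp0 : P.complex.d 1 0 ≫ p = 0 := P.complex_d_comp_π_f_zero
  have hpe : Epi p := inferInstanceAs (Epi (P.π.f 0))
  let a : P.complex.X 0 ⟶ T.X₂ := Projective.factorThru p T.g
  have ha : a ≫ T.g = p := Projective.factorThru_comp p T.g
  have hda : (P.complex.d 1 0 ≫ a) ≫ T.g = 0 := by rw [Category.assoc, ha, hp0]
  let φ : P.complex.X 1 ⟶ T.X₁ := hT.exact.lift _ hda
  have hφ : φ ≫ T.f = P.complex.d 1 0 ≫ a := hT.exact.lift_f _ hda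
  obtain ⟨ψ, hψ⟩ := key φ (by
    rw [← cancel_mono T.f, Category.assoc, hφ, ← Category.assoc]; simp)
  have hz : P.complex.d 1 0 ≫ (a - ψ ≫ T.f) = 0 := by
    rw [Preadditive.comp_sub, ← Category.assoc _ ψ, hψ, hφ, sub_self]
  let s : T.X₃ ⟶ T.X₂ := P.isColimitCokernelCofork.desc (CokernelCofork.ofπ _ hz)
  have hs : p ≫ s = a - ψ ≫ T.f :=
    P.isColimitCokernelCofork.fac (CokernelCofork.ofπ _ hz) WalkingParallelPair.one
  have hsg : s ≫ T.g = 𝟙 _ := by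
    rw [← cancel_epi p, ← Category.assoc, hs, Preadditive.sub_comp, ha]; simp
  have hr : (𝟙 _ - T.g ≫ s) ≫ T.g = 0 := by
    rw [Preadditive.sub_comp, Category.assoc, hsg]; simp
  refine ⟨hT.exact.lift _ hr, ?_⟩
  rw [← cancel_mono T.f, Category.assoc, hT.exact.lift_f]
  simp [Preadditive.comp_sub]

lemma dvd_sub_rho (f : S) :
    (X 0 : S) ∣ f - aeval (fun i : Fin 3 => if i = 0 then (0 : S) else X i) f := by
  induction f using MvPolynomial.induction_on with
  | C a => simp
  | add p q hp hq =>
    rw [map_add, add_sub_add_comm]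
    exact dvd_add hp hq
  | mul_X p i hp =>
    rw [map_mul, aeval_X]
    split_ifs with h
    · subst h; simp
    · rw [← sub_mul]; exact hp.mul_right _

/-- Second syzygies: exactness of the Koszul complex on `x, y, x + 3y - 3z`. -/
lemma koszul_one (A B D : S) (h : A * (X 0 + 3 * X 1 - 3 * X 2) + B * X 0 + D * X 1 = 0) :
    ∃ u v w : S, A = X 0 * v - X 1 * u ∧ B = X 1 * w - (X 0 + 3 * X 1 - 3 * X 2) * v ∧
      D = (X 0 + 3 * X 1 - 3 * X 2) * u - X 0 * w := by
  obtain ⟨A1, hA⟩ := dvd_sub_rho A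
  obtain ⟨D1, hD⟩ := dvd_sub_rho D
  have hh := congrArg (aeval (fun i : Fin 3 => if i = 0 then (0 : S) else X i)) h
  simp only [map_add, map_sub, map_mul, map_ofNat, map_zero, aeval_X, if_true, zero_add, mul_zero, add_zero,
    show (1 : Fin 3) ≠ 0 by decide, show (2 : Fin 3) ≠ 0 by decide, if_false] at hh
  generalize (aeval (fun i : Fin 3 => if i = 0 then (0 : S) else X i)) A = A0 at *
  generalize (aeval (fun i : Fin 3 => if i = 0 then (0 : S) else X i)) D = D0 at *
  have hy : Prime (X 1 : S) := (X_prime)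
  have hx0 : (X 0 : S) ≠ 0 := X_ne_zero 0
  have hd : (X 1 : S) ∣ A0 * (3 * X 1 - 3 * X 2) := ⟨-D0, by linear_combination hh⟩
  rcases hy.dvd_or_dvd hd with ⟨u, hu⟩ | ⟨q, hq⟩
  · have hD0 : D0 = - u * (3 * X 1 - 3 * X 2) := by
      apply mul_right_cancel₀ hy.ne_zero
      rw [hu] at hh
      linear_combination hh
    refine ⟨-u, A1, -u - D1, by linear_combination hA + hu, ?_, by linear_combination hD + hD0⟩
    apply mul_right_cancel₀ hx0
    linear_combination h - (X 0 + 3 * X 1 - 3 * X 2) * (hA + hu) - X 1 * (hD + hD0)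
  · exfalso
    have := congrArg (eval (fun i : Fin 3 => if i = 2 then (1 : ℚ) else 0)) hq
    simp at this

lemma koszul_two (u v w : S) (h1 : X 0 * v = X 1 * u)
    (h2 : (X 0 + 3 * X 1 - 3 * X 2) * u = X 0 * w) :
    ∃ t : S, u = t * X 0 ∧ v = t * X 1 ∧ w = t * (X 0 + 3 * X 1 - 3 * X 2) := by
  have hx : Prime (X 0 : S) := (X_prime)
  have hx0 : (X 0 : S) ≠ 0 := hx.ne_zero
  have hd : (X 0 : S) ∣ X 1 * u := ⟨v, h1.symm⟩
  rcases hx.dvd_or_dvd hd with ⟨q, hq⟩ | ⟨t, ht⟩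
  · exfalso
    have := congrArg (eval (fun i : Fin 3 => if i = 1 then (1 : ℚ) else 0)) hq
    simp at this
  · refine ⟨t, by rw [ht, mul_comm], ?_, ?_⟩ <;> apply mul_left_cancel₀ hx0
    · rw [h1, ht]; ring
    · rw [← h2, ht]; ring

/-- Membership in `M` spelled out. -/
lemma mem_M_iff (g : Fin 6 → S) : g ∈ M ↔
    (X 0 + 3 * X 1 - 3 * X 2 : S) ∣ g 0 - g 1 ∧ (X 0 : S) ∣ g 0 - g 3 ∧
    (4 * X 0 - X 1 + 3 * X 2 : S) ∣ g 2 - g 3 ∧ (X 0 - X 1 : S) ∣ g 2 - g 5 ∧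
    (X 1 : S) ∣ g 1 - g 4 ∧ (3 * X 0 - 4 * X 1 - 3 * X 2 : S) ∣ g 4 - g 5 := by
  change (∀ c ∈ _, _) ↔ _
  simp

/-- The vector of splines with parameters `(u, v, w, a3, a4, a5, g1)`. -/
noncomputable def paramFun (e : Fin 7 → S) : Fin 6 → S :=
  ![e 6,
    e 6 - (X 0 + 3 * X 1 - 3 * X 2) * ((X 0 * e 1 - X 1 * e 0) - e 3 + e 5),
    e 6 + X 0 * (X 1 * e 2 - (X 0 + 3 * X 1 - 3 * X 2) * e 1 - 2 * e 3 - e 4 - 5 * e 5)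
      + (4 * X 0 - X 1 + 3 * X 2) * e 5,
    e 6 + X 0 * (X 1 * e 2 - (X 0 + 3 * X 1 - 3 * X 2) * e 1 - 2 * e 3 - e 4 - 5 * e 5),
    e 6 - (X 0 + 3 * X 1 - 3 * X 2) * ((X 0 * e 1 - X 1 * e 0) - e 3 + e 5)
      - X 1 * ((X 0 + 3 * X 1 - 3 * X 2) * e 0 - X 0 * e 2 + 7 * e 3 + e 4 - 2 * e 5),
    e 6 + X 0 * (X 1 * e 2 - (X 0 + 3 * X 1 - 3 * X 2) * e 1 - 2 * e 3 - e 4 - 5 * e 5)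
      + (4 * X 0 - X 1 + 3 * X 2) * e 5 + (X 0 - X 1) * e 4]

/-- `paramFun` as a linear map. -/
noncomputable def paramLin : (Fin 7 → S) →ₗ[S] (Fin 6 → S) where
  toFun := paramFun
  map_add' a b := by
    funext i
    fin_cases i <;> simp [paramFun] <;> ring
  map_smul' r a := by
    funext i
    fin_cases i <;> simp [paramFun] <;> ring

lemma paramLin_mem (e : Fin 7 → S) : paramLin e ∈ M := by
  change paramFun e ∈ M
  rw [mem_M_iff]
  simp only [paramFun, Matrix.cons_val]
  refine ⟨⟨(X 0 * e 1 - X 1 * e 0) - e 3 + e 5, by ring⟩,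
    ⟨-(X 1 * e 2 - (X 0 + 3 * X 1 - 3 * X 2) * e 1 - 2 * e 3 - e 4 - 5 * e 5), by ring⟩,
    ⟨e 5, by ring⟩, ⟨-e 4, by ring⟩,
    ⟨(X 0 + 3 * X 1 - 3 * X 2) * e 0 - X 0 * e 2 + 7 * e 3 + e 4 - 2 * e 5, by ring⟩,
    ⟨e 3, by ring⟩⟩

/-- The presentation `S^7 → M`. -/
noncomputable def presMap : (Fin 7 → S) →ₗ[S] M := paramLin.codRestrict M paramLin_mem

/-- The inclusion `S → S^7`. -/
noncomputable def inclMap : S →ₗ[S] (Fin 7 → S) :=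
  LinearMap.toSpanSingleton S _ ![X 0, X 1, X 0 + 3 * X 1 - 3 * X 2, 0, 0, 0, 0]

lemma inclMap_injective : Function.Injective inclMap := by
  intro a b h
  have := congrFun h 0
  simp [inclMap] at this
  exact this

lemma presMap_surjective : Function.Surjective presMap := by
  rintro ⟨g, hg⟩
  obtain ⟨⟨a1, h1⟩, ⟨b6, h6⟩, ⟨a5, h5⟩, ⟨b4, h4⟩, ⟨a2, h2⟩, ⟨a3, h3⟩⟩ := (mem_M_iff g).1 hg
  obtain ⟨u, v, w, hA, hB, hD⟩ := koszul_one (a1 + a3 - a5) (-b6 + 2 * a3 - b4 + 5 * a5)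
    (a2 - 7 * a3 + b4 + 2 * a5) (by linear_combination -h1 - h2 - h3 + h4 - h5 + h6)
  refine ⟨![u, v, w, a3, -b4, a5, g 0], Subtype.ext ?_⟩
  change paramFun _ = g
  funext i
  fin_cases i <;> simp [paramFun]
  · rw [← hA]; linear_combination h1
  · rw [← hB]; linear_combination h6 - h5
  · rw [← hB]; linear_combination h6
  · rw [← hA, ← hD]; linear_combination h1 + h2
  · rw [← hB]; linear_combination h6 - h5 + h4

lemma presMap_exact : Function.Exact inclMap presMap := by
  intro e
  constructor
  · intro h
    have h' : paramFun e = 0 := congrArg Subtype.val h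
    have k0 := congrFun h' 0
    have k1 := congrFun h' 1
    have k2 := congrFun h' 2
    have k3 := congrFun h' 3
    have k4 := congrFun h' 4
    have k5 := congrFun h' 5
    simp only [paramFun, Matrix.cons_val, Pi.zero_apply] at k0 k1 k2 k3 k4 k5
    have nz : ∀ (f : S) (q : Fin 3 → ℚ), eval q f ≠ 0 → f ≠ 0 := by
      rintro f q hq rfl
      simp at hq
    have n1 : (X 0 + 3 * X 1 - 3 * X 2 : S) ≠ 0 :=
      nz _ (fun i => if i = 0 then 1 else 0) (by simp)
    have n3 : (3 * X 0 - 4 * X 1 - 3 * X 2 : S) ≠ 0 :=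
      nz _ (fun i => if i = 0 then 1 else 0) (by simp)
    have n4 : (X 0 - X 1 : S) ≠ 0 :=
      nz _ (fun i => if i = 0 then 1 else 0) (by simp)
    have n5 : (4 * X 0 - X 1 + 3 * X 2 : S) ≠ 0 :=
      nz _ (fun i => if i = 0 then 1 else 0) (by simp)
    have e5 : e 5 = 0 := by
      apply mul_left_cancel₀ n5
      linear_combination k2 - k3
    have e4 : e 4 = 0 := by
      apply mul_left_cancel₀ n4
      linear_combination k5 - k2
    have e3 : e 3 = 0 := by
      apply mul_left_cancel₀ n3
      linear_combination k4 - k5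
    have r1 : X 0 * e 1 = X 1 * e 0 := by
      apply mul_left_cancel₀ n1
      rw [e3, e5] at k1
      linear_combination k0 - k1
    have r2 : (X 0 + 3 * X 1 - 3 * X 2) * e 0 = X 0 * e 2 := by
      apply mul_left_cancel₀ (X_ne_zero 1 : (X 1 : S) ≠ 0)
      rw [e3, e5, e4] at k4
      rw [e3, e5] at k1
      linear_combination k1 - k4
    obtain ⟨t, t0, t1, t2⟩ := koszul_two _ _ _ r1 r2
    refine ⟨t, ?_⟩
    funext i
    fin_cases i <;> simp [inclMap, *]
  · rintro ⟨t, rfl⟩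
    apply Subtype.ext
    change paramFun _ = 0
    funext i
    fin_cases i <;> simp only [paramFun, inclMap, LinearMap.toSpanSingleton_apply, Pi.smul_apply,
      smul_eq_mul, Matrix.cons_val, Pi.zero_apply, Fin.reduceFinMk, Fin.zero_eta, Fin.mk_one] <;> ring

/-- **Theorem (a simplicial nonfree example)**: the spline module `M = C^0(Σ)` of the
cone over the triangulated annulus is not a free `S`-module; equivalently
`Ext^1_S(M, S) ≠ 0` (so the associated reflexive sheaf on `ℙ²`, a rank-6 vector
bundle, does not split as a direct sum of line bundles). -/
theorem annulus_spline_module_not_free :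
    ¬ Module.Free S M ∧ ¬ IsZero (extAgainstRing 1 (ModuleCat.of S M)) := by
  have hext : ¬ IsZero (extAgainstRing 1 (ModuleCat.of S M)) := by
    intro h
    let T : ShortComplex (ModuleCat.{0} S) :=
      ShortComplex.mk (ModuleCat.ofHom inclMap) (ModuleCat.ofHom presMap) (by
        rw [← ModuleCat.ofHom_comp, presMap_exact.linearMap_comp_eq_zero]
        rfl)
    have hT : T.ShortExact :=
      ModuleCat.shortComplex_shortExact T presMap_exact inclMap_injective presMap_surjective
    obtain ⟨r, hr⟩ := exists_retraction_of_isZero_ext T hT h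
    let r' : (Fin 7 → S) →ₗ[S] S := r.hom
    have h1 : r' (inclMap 1) = 1 := congrArg (fun f => f.hom (1 : S)) hr
    have h2 : inclMap 1 = (X 0 : S) • Pi.single 0 1 + (X 1 : S) • Pi.single 1 1 +
        (X 0 + 3 * X 1 - 3 * X 2 : S) • Pi.single 2 1 := by
      funext i
      fin_cases i <;> simp [inclMap]
    rw [h2] at h1
    simp only [map_add, map_smul, smul_eq_mul] at h1
    have h3 := congrArg constantCoeff h1
    simp at h3
  refine ⟨fun hfree => hext ?_, hext⟩
  have : Projective (ModuleCat.of S M) := by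
    rw [← IsProjective.iff_projective]
    infer_instance
  exact isZero_Ext_succ_of_projective _ _ 0
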